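/- arXiv:1601.06685 — 5 statements merged into one kernel-verified Lean document; each statement's English description precedes it below -/
import Mathlib

section
/- For every integer n ≥ 1, we have (n+3)·C_n = 2·Σ_{k=0}^{n−1} C(n,k)·2^{|n−2−k|}, where C_n = C(n,n) is the n-th Catalan number and C(n,k) denotes the Catalan triangle number. -/
/-- The Catalan triangle numbers: `C(n,k) = (n+k)! * (n-k+1) / (k! * (n+1)!)`,
with `C(n,k) = 0` for `k > n` (via truncated subtraction). -/
def catalanTriangle (n k : ℕ) : ℕ :=
  (n + k).factorial * (n + 1 - k) / (k.factorial * (n + 1).factorial)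

lemma ct_zero (n : ℕ) : catalanTriangle n 0 = 1 := by
  unfold catalanTriangle
  simp only [Nat.add_zero, Nat.sub_zero, Nat.factorial_zero, one_mul]
  rw [Nat.factorial_succ, mul_comm]
  exact Nat.div_self (by positivity)

lemma ct_succ (n k : ℕ) (h : k ≤ n) :
    catalanTriangle n (k + 1) + (n + k + 1).choose k = (n + k + 1).choose (k + 1) := by
  have h1 := Nat.choose_succ_right_eq (n + k + 1) k
  rw [show n + k + 1 - k = n + 1 by omega] at h1
  have h2 := Nat.choose_mul_factorial_mul_factorial (show k ≤ n + k + 1 by omega)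
  rw [show n + k + 1 - k = n + 1 by omega] at h2
  obtain ⟨d, rfl⟩ := Nat.exists_eq_add_of_le h
  generalize ha : (k + d + k + 1).choose k = a at *
  generalize hb : (k + d + k + 1).choose (k + 1) = b at *
  have hab : a ≤ b := by nlinarith
  obtain ⟨e, rfl⟩ := Nat.exists_eq_add_of_le hab
  have h3 : e * (k + 1) = a * d := by nlinarith
  have : catalanTriangle (k + d) (k + 1) = e := by
    unfold catalanTriangle
    rw [show k + d + 1 - (k + 1) = d by omega, ← add_assoc, ← h2]
    apply Nat.div_eq_of_eq_mul_left (by positivity)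
    rw [Nat.factorial_succ k]
    calc a * k.factorial * (k + d + 1).factorial * d
        = (a * d) * (k.factorial * (k + d + 1).factorial) := by ring
      _ = _ := by rw [← h3]; ring
  omega

lemma ct_sum (n m : ℕ) (h : m ≤ n) :
    ∑ k ∈ Finset.range (m + 1), catalanTriangle n k * 2 ^ (m - k) = (n + m + 1).choose m := by
  induction m with
  | zero => simp [ct_zero]
  | succ m ih =>
    rw [Finset.sum_range_succ]
    have : ∑ k ∈ Finset.range (m + 1), catalanTriangle n k * 2 ^ (m + 1 - k)
        = 2 * ∑ k ∈ Finset.range (m + 1), catalanTriangle n k * 2 ^ (m - k) := by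
      rw [Finset.mul_sum]
      apply Finset.sum_congr rfl
      intro k hk
      rw [Finset.mem_range] at hk
      rw [show m + 1 - k = (m - k) + 1 by omega, pow_succ]
      ring
    rw [this, ih (by omega)]
    have h1 := ct_succ n m (by omega)
    have h2 := Nat.choose_succ_succ' (n + m + 1) m
    rw [show n + (m + 1) + 1 = n + m + 1 + 1 by ring, h2]
    simp only [Nat.sub_self, pow_zero, mul_one]
    omega

theorem stmt_3 (n : ℕ) (hn : 1 ≤ n) :
    (n + 3) * catalanTriangle n n =
      2 * ∑ k ∈ Finset.range n,
        catalanTriangle n k * 2 ^ ((n : ℤ) - 2 - (k : ℤ)).natAbs := by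
  obtain _ | _ | p := n
  · omega
  · have h := ct_succ 1 0 (by omega)
    have h0 := ct_zero 1
    norm_num at h
    norm_num [h0]
    omega
  · have hs : ∑ k ∈ Finset.range (p + 1),
        catalanTriangle (p + 2) k * 2 ^ (((p + 1 + 1 : ℕ) : ℤ) - 2 - (k : ℤ)).natAbs
        = ∑ k ∈ Finset.range (p + 1), catalanTriangle (p + 2) k * 2 ^ (p - k) := by
      apply Finset.sum_congr rfl
      intro k hk
      rw [Finset.mem_range] at hk
      congr 2
      omega
    rw [Finset.sum_range_succ, hs, ct_sum _ _ (by omega)]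
    rw [show (((p + 1 + 1 : ℕ) : ℤ) - 2 - ((p + 1 : ℕ) : ℤ)).natAbs = 1 by omega]
    have h1 := ct_succ (p + 2) (p + 1) (by omega)
    have h2 := ct_succ (p + 2) p (by omega)
    rw [show p + 2 + (p + 1) + 1 = p + 2 + p + 1 + 1 by ring, Nat.choose_succ_succ' _ p,
      Nat.choose_succ_succ' _ (p + 1)] at h1
    have h3 : (p + 2 + p + 1).choose (p + 1 + 1) = (p + 2 + p + 1).choose (p + 1) :=
      Nat.choose_symm_of_eq_add (by ring)
    have h4 := Nat.choose_succ_right_eq (p + 2 + p + 1) p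
    rw [show p + 2 + p + 1 - p = p + 3 by omega] at h4
    rw [h3] at h1
    have h5 : catalanTriangle (p + 2) (p + 1 + 1) = catalanTriangle (p + 2) (p + 1) := by omega
    change (p + 2 + 3) * catalanTriangle (p + 2) (p + 1 + 1) = _
    rw [h5]
    change _ = 2 * (_ + catalanTriangle (p + 2) (p + 1) * 2 ^ 1)
    rw [← h2] at h4
    nlinarith
end

section
/- For every integer n ≥ 0, the binomial coefficient C(n+1, ⌊(n+1)/2⌋) satisfies C(n+1, ⌊(n+1)/2⌋) = Σ_{s=0}^{⌊n/2⌋} C(⌊n/2⌋, s)·2^{⌈n/2⌉−s}, where C(⌊n/2⌋, s) denotes the Catalan triangle number. -/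
theorem cat_zero (m : ℕ) : catalanTriangle m 0 = 1 := by
  unfold catalanTriangle
  have h : m.factorial * (m + 1) = (m+1).factorial := by rw [Nat.factorial_succ, mul_comm]
  simp only [Nat.add_zero, Nat.sub_zero, h, Nat.factorial_zero, one_mul]
  exact Nat.div_self (Nat.factorial_pos _)

theorem cat_succ (m s : ℕ) (h : s ≤ m) :
    catalanTriangle m (s+1) + (m+s+1).choose s = (m+s+1).choose (s+1) := by
  have h1 := Nat.add_choose_mul_factorial_mul_factorial m (s+1)
  have h2 := Nat.add_choose_mul_factorial_mul_factorial (m+1) s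
  rw [← add_assoc] at h1
  rw [show m + 1 + s = m+s+1 by ring] at h2
  obtain ⟨d, rfl⟩ := Nat.exists_eq_add_of_le h
  have hle : (s+d+s+1).choose s ≤ (s+d+s+1).choose (s+1) := by
    rcases Nat.eq_zero_or_pos d with rfl | hd
    · exact (Nat.choose_symm_of_eq_add (by ring)).le
    · apply Nat.choose_le_succ_of_lt_half_left
      omega
  obtain ⟨D, hD⟩ := Nat.exists_eq_add_of_le hle
  rw [hD] at h1 ⊢
  have key : catalanTriangle (s+d) (s+1) = D := by
    unfold catalanTriangle
    apply Nat.div_eq_of_eq_mul_left (by positivity)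
    rw [show s + d + 1 - (s+1) = d by omega, ← add_assoc]
    zify at h1 h2 ⊢
    rw [Nat.factorial_succ (s+d)] at h2 ⊢
    rw [Nat.factorial_succ s] at h1 ⊢
    push_cast at h1 h2 ⊢
    linear_combination (-(s+d+1:ℤ)) * h1 + (s+1:ℤ) * h2
  rw [key]; ring

theorem part_sum (m j : ℕ) (h : j ≤ m) :
    ∑ s ∈ Finset.range (j+1), catalanTriangle m s * 2^(j-s) = (m+j+1).choose j := by
  induction j with
  | zero => simp [cat_zero]
  | succ j ih =>
    rw [Finset.sum_range_succ]
    have : ∑ s ∈ Finset.range (j+1), catalanTriangle m s * 2^(j+1-s)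
        = 2 * (m+j+1).choose j := by
      rw [← ih (by omega), Finset.mul_sum]
      apply Finset.sum_congr rfl
      intro s hs
      rw [Finset.mem_range] at hs
      rw [show j + 1 - s = (j - s) + 1 by omega, pow_succ]
      ring
    have c := cat_succ m j (by omega)
    rw [this, show m + (j+1) + 1 = (m+j+1)+1 by ring, Nat.choose_succ_succ]
    simp only [Nat.sub_self, pow_zero, mul_one, Nat.succ_eq_add_one]
    omega

theorem stmt_4 (n : ℕ) :
    (n + 1).choose ((n + 1) / 2) =
      ∑ s ∈ Finset.range (n / 2 + 1),
        catalanTriangle (n / 2) s * 2 ^ ((n + 1) / 2 - s) := by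
  have p := part_sum (n/2) (n/2) le_rfl
  obtain ⟨m, hm | hm⟩ := Nat.even_or_odd' n
  · have a : n / 2 = m := by omega
    have b : (n+1) / 2 = m := by omega
    rw [a] at p
    rw [a, b, p, hm, two_mul]
  · have a : n / 2 = m := by omega
    have b : (n+1) / 2 = m + 1 := by omega
    rw [a] at p
    rw [a, b]
    have : ∑ s ∈ Finset.range (m+1), catalanTriangle m s * 2^(m+1-s)
        = 2 * (m+m+1).choose m := by
      rw [← p, Finset.mul_sum]
      apply Finset.sum_congr rfl
      intro s hs
      rw [Finset.mem_range] at hs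
      rw [show m + 1 - s = (m - s) + 1 by omega, pow_succ]
      ring
    rw [this, hm, show 2 * m + 1 + 1 = (m+m+1)+1 by ring, Nat.choose_succ_succ,
      Nat.succ_eq_add_one, Nat.choose_symm_of_eq_add (show m+m+1 = (m+1) + m by ring)]
    ring
end

section
/- For every integer k ≥ 1, the binomial coefficient binom(2k, k−1) satisfies binom(2k, k−1) = Σ_{s=0}^{k−1} C(k, s)·2^{k−1−s}, where C(k,s) denotes the Catalan triangle number. -/
theorem catTri_succ (n m : ℕ) (h : m ≤ n) :
    (n + m + 1).choose (m + 1) = catalanTriangle n (m + 1) + (n + m + 1).choose m := by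
  have h1 := Nat.add_choose_mul_factorial_mul_factorial n (m + 1)
  have h2 := Nat.add_choose_mul_factorial_mul_factorial (n + 1) m
  rw [show n + (m + 1) = n + m + 1 by ring] at h1
  rw [show n + 1 + m = n + m + 1 by ring] at h2
  obtain ⟨d, rfl⟩ := Nat.exists_eq_add_of_le h
  generalize hA : (m + d + m + 1).choose (m + 1) = A at *
  generalize hB : (m + d + m + 1).choose m = B at *
  have key : ((m + 1).factorial * (m + d + 1).factorial) * A =
      (m + d + m + 1).factorial * d + ((m + 1).factorial * (m + d + 1).factorial) * B := by
    have f1 := Nat.factorial_succ m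
    have f2 := Nat.factorial_succ (m + d)
    calc _ = (m + d + 1) * (A * (m + d).factorial * (m + 1).factorial) := by rw [f2]; ring
      _ = (m + d + m + 1).factorial * d + (m + 1) * (m + d + m + 1).factorial := by rw [h1]; ring
      _ = _ := by rw [f1]; nth_rewrite 2 [← h2]; ring
  have hp : 0 < (m + 1).factorial * (m + d + 1).factorial := by positivity
  have hBA : B ≤ A := by
    refine Nat.le_of_mul_le_mul_left ?_ hp
    omega
  obtain ⟨c, rfl⟩ := Nat.exists_eq_add_of_le hBA
  have : catalanTriangle (m + d) (m + 1) = c := by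
    unfold catalanTriangle
    rw [show m + d + 1 - (m + 1) = d by omega, ← add_assoc]
    apply Nat.div_eq_of_eq_mul_right hp
    rw [mul_add] at key
    omega
  omega

theorem catTri_sum (n m : ℕ) (h : m ≤ n) :
    (n + m + 1).choose m = ∑ s ∈ Finset.range (m + 1), catalanTriangle n s * 2 ^ (m - s) := by
  induction m with
  | zero =>
    simp only [zero_add, Finset.sum_range_one, catalanTriangle]
    simp [Nat.factorial_succ, mul_comm, Nat.div_self, Nat.factorial_pos]
  | succ m ih =>
    rw [Finset.sum_range_succ]
    have : ∑ s ∈ Finset.range (m + 1), catalanTriangle n s * 2 ^ (m + 1 - s)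
        = 2 * ∑ s ∈ Finset.range (m + 1), catalanTriangle n s * 2 ^ (m - s) := by
      rw [Finset.mul_sum]
      refine Finset.sum_congr rfl fun s hs => ?_
      have := Finset.mem_range.mp hs
      rw [show m + 1 - s = (m - s) + 1 by omega, pow_succ]; ring
    rw [this, ← ih (by omega)]
    have := catTri_succ n m (by omega)
    rw [show n + (m + 1) + 1 = (n + m + 1) + 1 by ring, Nat.choose_succ_succ']
    simp
    omega

theorem stmt_6 (k : ℕ) (hk : 1 ≤ k) :
    (2 * k).choose (k - 1) =
      ∑ s ∈ Finset.range k, catalanTriangle k s * 2 ^ (k - 1 - s) := by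
  have := catTri_sum k (k - 1) (by omega)
  rw [show k + (k - 1) + 1 = 2 * k by omega, show k - 1 + 1 = k by omega] at this
  exact this
end

section
/- For every integer t ≥ 0, in the ring of formal power series ℤ[[x]] one has (1−x)·(1+x)^t · (Σ_{m=0}^{∞} A(m+t, t)·x^m) = 1, where A denotes the alternating Jacobsthal triangle number; that is, Σ_{m=t}^{∞} A(m,t)·x^{m−t} is the multiplicative inverse of (1−x)(1+x)^t. -/
/-- The alternating Jacobsthal triangle numbers: `A(m,0) = 1`,
`A(m,t) = A(m-1,t-1) - A(m-1,t)` for `m ≥ t ≥ 1`, and `A(m,t) = 0` for `t > m`. -/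
def altJacobsthal : ℕ → ℕ → ℤ
  | _, 0 => 1
  | 0, _ + 1 => 0
  | m + 1, t + 1 => altJacobsthal m t - altJacobsthal m (t + 1)

theorem altJ_zero (m : ℕ) : ∀ t, m < t → altJacobsthal m t = 0 := by
  induction m with
  | zero =>
    intro t ht
    obtain ⟨t, rfl⟩ := Nat.exists_eq_succ_of_ne_zero (by omega : t ≠ 0)
    simp [altJacobsthal]
  | succ m ih =>
    intro t ht
    obtain ⟨t, rfl⟩ := Nat.exists_eq_succ_of_ne_zero (by omega : t ≠ 0)
    simp only [Nat.succ_eq_add_one, altJacobsthal]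
    rw [ih t (by omega), ih (t + 1) (by omega)]
    rfl

theorem altJ_step (t : ℕ) :
    ((1 + PowerSeries.X) * PowerSeries.mk (fun m => altJacobsthal (m + (t + 1)) (t + 1)) :
      PowerSeries ℤ) = PowerSeries.mk (fun m => altJacobsthal (m + t) t) := by
  ext n
  rw [add_mul, one_mul, map_add]
  cases n with
  | zero =>
    rw [PowerSeries.coeff_zero_X_mul, PowerSeries.coeff_mk, PowerSeries.coeff_mk]
    rw [Nat.zero_add, Nat.zero_add, altJacobsthal]
    rw [altJ_zero t (t + 1) (by omega)]
    ring
  | succ n =>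
    rw [PowerSeries.coeff_succ_X_mul, PowerSeries.coeff_mk, PowerSeries.coeff_mk,
      PowerSeries.coeff_mk]
    have e : altJacobsthal (n + 1 + (t + 1)) (t + 1)
        = altJacobsthal (n + 1 + t) t - altJacobsthal (n + 1 + t) (t + 1) := by
      rw [← Nat.add_assoc, altJacobsthal]
    rw [e, show n + (t + 1) = n + 1 + t by omega]
    ring

theorem stmt_11 (t : ℕ) :
    ((1 - PowerSeries.X) * (1 + PowerSeries.X) ^ t *
        PowerSeries.mk (fun m => altJacobsthal (m + t) t) : PowerSeries ℤ) = 1 := by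
  induction t with
  | zero =>
    ext n
    rw [pow_zero, mul_one, sub_mul, one_mul, map_sub]
    cases n with
    | zero => simp [altJacobsthal]
    | succ n =>
      rw [PowerSeries.coeff_succ_X_mul]
      simp [altJacobsthal, PowerSeries.coeff_one]
  | succ t ih =>
    rw [pow_succ, ← mul_assoc, mul_assoc _ (1 + PowerSeries.X), altJ_step, ih]
end

section
/- For every integer m ≥ 1, Σ_{t=1}^{m} (−1)^{m−t}·A(m,t) = J_m, where A denotes the alternating Jacobsthal triangle number and J_m is the m-th Jacobsthal number; in other words, the alternating sum of the entries (excluding the 0-th column) along the m-th row of the alternating Jacobsthal triangle equals the m-th Jacobsthal number. -/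
/-- The Jacobsthal numbers: $J_1 = J_2 = 1$ and $J_m = J_{m-1} + 2 J_{m-2}$. -/
def jacobsthal : ℕ → ℤ
  | 0 => 0
  | 1 => 1
  | m + 2 => jacobsthal (m + 1) + 2 * jacobsthal m

theorem aj_zero : ∀ (m t : ℕ), m < t → altJacobsthal m t = 0
  | _, 0, h => by omega
  | 0, _ + 1, _ => by simp [altJacobsthal]
  | m + 1, t + 1, h => by
    rw [altJacobsthal, aj_zero m t (by omega), aj_zero m (t + 1) (by omega)]; simp

theorem jac_succ (m : ℕ) : jacobsthal (m + 1) = 2 * jacobsthal m + (-1) ^ m := by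
  induction m with
  | zero => simp [jacobsthal]
  | succ k ih => rw [jacobsthal, ih]; ring

theorem aj_sum (m : ℕ) :
    ∑ s ∈ Finset.range m, (-1 : ℤ) ^ (m + s + 1) * altJacobsthal m (s + 1) = jacobsthal m := by
  induction m with
  | zero => simp [jacobsthal]
  | succ k ih =>
    have h0 : altJacobsthal k 0 = 1 := by cases k <;> simp [altJacobsthal]
    have e1 : ∑ s ∈ Finset.range (k + 1), (-1 : ℤ) ^ (k + s) * altJacobsthal k s
        = jacobsthal k + (-1) ^ k := by
      rw [Finset.sum_range_succ', ← ih, h0]; simp [add_assoc]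
    have e2 : ∑ s ∈ Finset.range (k + 1), (-1 : ℤ) ^ (k + s + 1) * altJacobsthal k (s + 1)
        = jacobsthal k := by
      rw [Finset.sum_range_succ, ih, aj_zero k (k + 1) (by omega)]; simp
    have : jacobsthal (k + 1) = (jacobsthal k + (-1) ^ k) + jacobsthal k := by
      rw [jac_succ]; ring
    rw [this, ← e1]
    conv_rhs => rw [← e2]
    rw [← Finset.sum_add_distrib]
    apply Finset.sum_congr rfl
    intro s _
    rw [altJacobsthal]; ring

theorem stmt_19 (m : ℕ) (hm : 1 ≤ m) :
    (∑ t ∈ Finset.Icc 1 m, (-1 : ℤ) ^ (m - t) * altJacobsthal m t) = jacobsthal m := by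
  rw [← aj_sum m, Finset.range_eq_Ico]
  refine Eq.trans ?_ (Finset.sum_Ico_add'
    (fun t => (-1 : ℤ) ^ (m + t) * altJacobsthal m t) 0 m 1).symm
  apply Finset.sum_congr
  · ext; simp
  · intro t ht
    have := Finset.mem_Ico.1 ht
    have h : m + t = (m - t) + 2 * t := by omega
    rw [h, pow_add, pow_mul]; simp
end
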